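/- Let U ∈ C³(ℝ^n, ℝ), set Q_U(z) := D²U(0)(z,z), and assume ω0|z|² ≤ Q_U(z) ≤ ω0^{−1}|z|² for all z ∈ ℝ^n for some ω0 ∈ (0,1), and U(z) − U(0) − DU(0)(z) ≥ ω|z|² for all z ∈ ℝ^n, where 0 < ω ≤ ω0/8. Then there exists δ0 > 0, depending only on ω, ω0 and on sup_{|ξ|≤1} Σ_{|α|=3} |∂^α U(ξ)|/α!, such that for all β ≥ 1, all w ∈ ℝ^n with |w| ≤ δ0, and all z ∈ ℝ^n: β·( U(w + β^{−1/2} z) − U(w) − DU(w)(β^{−1/2} z) ) ≥ (ω/2)|z|². -/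

import Mathlib

open scoped BigOperators

/-- Partial derivative in the coordinate direction `i` on `EuclideanSpace ℝ ι`. -/
noncomputable def epd {ι : Type} [Fintype ι] [DecidableEq ι] (i : ι)
    (f : EuclideanSpace ℝ ι → ℝ) : EuclideanSpace ℝ ι → ℝ :=
  fun z => fderiv ℝ f z (EuclideanSpace.single i 1)

/-- Iterated partial derivative in one coordinate direction. -/
noncomputable def epdPow {ι : Type} [Fintype ι] [DecidableEq ι] (i : ι) :
    ℕ → (EuclideanSpace ℝ ι → ℝ) → EuclideanSpace ℝ ι → ℝ
  | 0, f => f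
  | k + 1, f => epd i (epdPow i k f)

/-- Multiindex partial derivative `∂^α` on `EuclideanSpace ℝ ι`. -/
noncomputable def epdMulti {ι : Type} [Fintype ι] [DecidableEq ι] (α : ι → ℕ)
    (f : EuclideanSpace ℝ ι → ℝ) : EuclideanSpace ℝ ι → ℝ :=
  (Finset.univ : Finset ι).toList.foldr (fun i g => epdPow i (α i) g) f

/-- Multiindex factorial `α!`. -/
def emfact {ι : Type} [Fintype ι] (α : ι → ℕ) : ℕ := ∏ i, Nat.factorial (α i)

/-- The quadratic form `z ↦ D²U(0)(z,z)`. -/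
noncomputable def equad0 {ι : Type} [Fintype ι] (U : EuclideanSpace ℝ ι → ℝ)
    (z : EuclideanSpace ℝ ι) : ℝ :=
  fderiv ℝ (fderiv ℝ U) 0 z z

lemma epd_comm {ι : Type} [Fintype ι] [DecidableEq ι] {f : EuclideanSpace ℝ ι → ℝ}
    (hf : ContDiff ℝ 2 f) (i j : ι) : epd i (epd j f) = epd j (epd i f) := by
  funext z
  have hd : DifferentiableAt ℝ (fderiv ℝ f) z :=
    (hf.fderiv_right (m := 1) (by norm_num)).differentiable (by norm_num) z
  have hs : IsSymmSndFDerivAt ℝ f z := hf.contDiffAt.isSymmSndFDerivAt (by simp)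
  unfold epd
  rw [fderiv_clm_apply hd (differentiableAt_const _), fderiv_clm_apply hd (differentiableAt_const _)]
  simpa using hs _ _

lemma ContDiff.epd {ι : Type} [Fintype ι] [DecidableEq ι] {f : EuclideanSpace ℝ ι → ℝ}
    {m : ℕ} (hf : ContDiff ℝ (m + 1 : ℕ) f) (i : ι) : ContDiff ℝ m (epd i f) :=
  (hf.fderiv_right (m := m) (by norm_cast)).clm_apply contDiff_const

lemma contDiff_foldr_epd {ι : Type} [Fintype ι] [DecidableEq ι] {f : EuclideanSpace ℝ ι → ℝ}
    (l : List ι) {m : ℕ} (hf : ContDiff ℝ (m + l.length : ℕ) f) :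
    ContDiff ℝ m (l.foldr epd f) := by
  induction l generalizing m with
  | nil => simpa using hf
  | cons i l ih =>
    refine ContDiff.epd (ih ?_) i
    convert hf using 2
    simp only [List.length_cons]; ring

lemma List.Perm.foldr_epd_eq {ι : Type} [Fintype ι] [DecidableEq ι]
    {f : EuclideanSpace ℝ ι → ℝ} {l l' : List ι} (h : l.Perm l')
    (hf : ContDiff ℝ (l.length : ℕ) f) : l.foldr epd f = l'.foldr epd f := by
  induction h with
  | nil => rfl
  | cons i _ ih =>
    simp only [List.foldr_cons]
    rw [ih (hf.of_le (by simp))]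
  | swap i j l =>
    refine epd_comm (contDiff_foldr_epd l (m := 2) ?_) _ _
    convert hf using 2
    simp only [List.length_cons]; ring
  | trans h₁ _ ih₁ ih₂ => rw [ih₁ hf, ih₂ (h₁.length_eq ▸ hf)]

lemma epdPow_eq_foldr {ι : Type} [Fintype ι] [DecidableEq ι] (i : ι) (k : ℕ)
    (f : EuclideanSpace ℝ ι → ℝ) : epdPow i k f = (List.replicate k i).foldr epd f := by
  induction k with
  | zero => rfl
  | succ k ih => simp [epdPow, List.replicate_succ, ih]

lemma epdMulti_eq_foldr {ι : Type} [Fintype ι] [DecidableEq ι] (α : ι → ℕ)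
    (f : EuclideanSpace ℝ ι → ℝ) :
    epdMulti α f =
      ((Finset.univ : Finset ι).toList.flatMap fun i => List.replicate (α i) i).foldr epd f := by
  unfold epdMulti
  induction (Finset.univ : Finset ι).toList with
  | nil => rfl
  | cons i l ih =>
    rw [List.foldr_cons, ih, epdPow_eq_foldr, List.flatMap_cons, List.foldr_append]

lemma count_flatMap_replicate {ι : Type} [Fintype ι] [DecidableEq ι] (α : ι → ℕ) (j : ι) :
    ((Finset.univ : Finset ι).toList.flatMap fun i => List.replicate (α i) i).count j = α j := by
  rw [List.count_flatMap]
  have : (List.count j ∘ fun i => List.replicate (α i) i) = fun i => if i = j then α i else 0 := by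
    funext i; simp [List.count_replicate]
  rw [this, Finset.sum_map_toList]
  simp

lemma epdMulti_eq_foldr_of_count {ι : Type} [Fintype ι] [DecidableEq ι]
    {f : EuclideanSpace ℝ ι → ℝ} {l : List ι} {α : ι → ℕ} (hα : ∀ i, l.count i = α i)
    (hf : ContDiff ℝ (l.length : ℕ) f) : epdMulti α f = l.foldr epd f := by
  rw [epdMulti_eq_foldr]
  refine (List.Perm.foldr_epd_eq (List.perm_iff_count.2 fun i => ?_) hf).symm
  rw [hα, count_flatMap_replicate]

lemma continuous_epdMulti {ι : Type} [Fintype ι] [DecidableEq ι]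
    {f : EuclideanSpace ℝ ι → ℝ} {α : ι → ℕ} (hf : ContDiff ℝ (∑ i, α i : ℕ) f) :
    Continuous (epdMulti α f) := by
  rw [epdMulti_eq_foldr]
  refine (contDiff_foldr_epd _ (m := 0) ?_).continuous
  convert hf using 2
  simp [List.length_flatMap]

lemma epd_epd_epd_apply {ι : Type} [Fintype ι] [DecidableEq ι] {f : EuclideanSpace ℝ ι → ℝ}
    (hf : ContDiff ℝ 3 f) (i j k : ι) (z : EuclideanSpace ℝ ι) :
    epd i (epd j (epd k f)) z = fderiv ℝ (fderiv ℝ (fderiv ℝ f)) z (EuclideanSpace.single i 1)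
      (EuclideanSpace.single j 1) (EuclideanSpace.single k 1) := by
  have h1 : ContDiff ℝ 2 (fderiv ℝ f) := hf.fderiv_right (by norm_num)
  have h2 : ContDiff ℝ 1 (fderiv ℝ (fderiv ℝ f)) := h1.fderiv_right (by norm_num)
  have d1 := h1.differentiable (by norm_num)
  have d2 := h2.differentiable (by norm_num)
  have e2 : epd j (epd k f) = fun z => fderiv ℝ (fderiv ℝ f) z (EuclideanSpace.single j 1)
      (EuclideanSpace.single k 1) := by
    funext z
    unfold epd
    rw [fderiv_clm_apply (d1 z) (differentiableAt_const _)]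
    simp
  rw [e2]
  unfold epd
  rw [fderiv_clm_apply ((d2 z).clm_apply (differentiableAt_const _)) (differentiableAt_const _),
    fderiv_clm_apply (d2 z) (differentiableAt_const _)]
  simp

lemma EuclideanSpace.opNorm_le_sum_single {ι : Type} [Fintype ι] [DecidableEq ι] {F : Type*}
    [NormedAddCommGroup F] [NormedSpace ℝ F] (L : EuclideanSpace ℝ ι →L[ℝ] F) :
    ‖L‖ ≤ ∑ i, ‖L (EuclideanSpace.single i 1)‖ := by
  refine L.opNorm_le_bound (Finset.sum_nonneg fun _ _ => norm_nonneg _) fun v => ?_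
  have hv : v = ∑ i, v i • EuclideanSpace.single i (1 : ℝ) := by
    ext j
    simp [Pi.single_apply]
  calc ‖L v‖ = ‖∑ i, v i • L (EuclideanSpace.single i 1)‖ := by
        conv_lhs => rw [hv]
        simp only [map_sum, map_smul]
    _ ≤ ∑ i, ‖v i • L (EuclideanSpace.single i 1)‖ := norm_sum_le _ _
    _ ≤ ∑ i, ‖L (EuclideanSpace.single i 1)‖ * ‖v‖ := by
        refine Finset.sum_le_sum fun i _ => ?_
        rw [norm_smul, mul_comm]
        gcongr
        exact PiLp.norm_apply_le v i
    _ = _ := by rw [Finset.sum_mul]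

/-- The weighted sum of all third order partial derivatives at a point. -/
noncomputable def thirdOrderSum {n : ℕ} (U : EuclideanSpace ℝ (Fin n) → ℝ)
    (ξ : EuclideanSpace ℝ (Fin n)) : ℝ :=
  ∑ α ∈ (Finset.Iic (fun _ : Fin n => 3)).filter (fun α => ∑ i, α i = 3),
    |epdMulti α U ξ| / ((emfact α : ℕ) : ℝ)

lemma thirdOrderSum_nonneg {n : ℕ} (U : EuclideanSpace ℝ (Fin n) → ℝ)
    (ξ : EuclideanSpace ℝ (Fin n)) : 0 ≤ thirdOrderSum U ξ :=
  Finset.sum_nonneg fun _ _ => by positivity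

lemma continuous_thirdOrderSum {n : ℕ} {U : EuclideanSpace ℝ (Fin n) → ℝ}
    (hU : ContDiff ℝ 3 U) : Continuous (thirdOrderSum U) := by
  refine continuous_finsetSum _ fun α hα => ?_
  have hs : ∑ i, α i = 3 := (Finset.mem_filter.1 hα).2
  exact (continuous_epdMulti (by rw [hs]; exact hU)).abs.div_const _

lemma thirdOrderSum_le_sSup {n : ℕ} {U : EuclideanSpace ℝ (Fin n) → ℝ} (hU : ContDiff ℝ 3 U)
    {ξ : EuclideanSpace ℝ (Fin n)} (hξ : ‖ξ‖ ≤ 1) :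
    thirdOrderSum U ξ ≤
      sSup {y : ℝ | ∃ ξ : EuclideanSpace ℝ (Fin n), ‖ξ‖ ≤ 1 ∧ y = thirdOrderSum U ξ} := by
  refine le_csSup ?_ ⟨ξ, hξ, rfl⟩
  have hb := (isCompact_closedBall (0 : EuclideanSpace ℝ (Fin n)) 1).bddAbove_image
    (continuous_thirdOrderSum hU).continuousOn
  refine hb.mono ?_
  rintro y ⟨ζ, hζ, rfl⟩
  exact ⟨ζ, by simpa using hζ, rfl⟩

lemma emfact_le_six {n : ℕ} {α : Fin n → ℕ} (hα : ∑ i, α i = 3) : emfact α ≤ 6 := by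
  have h := Nat.le_of_dvd (Nat.factorial_pos _)
    (Nat.prod_factorial_dvd_factorial_sum Finset.univ α)
  rw [hα] at h
  exact h

lemma card_fiber_single_le {n : ℕ} (α : Fin n → ℕ) (hα : ∑ i, α i = 3) :
    ((Finset.univ : Finset (Fin n × Fin n × Fin n)).filter (fun p =>
      Pi.single p.1 1 + Pi.single p.2.1 1 + Pi.single p.2.2 1 = α)).card ≤ 27 := by
  classical
  set s : Finset (Fin n) := Finset.univ.filter (fun l => α l ≠ 0) with hs
  have hcard : s.card ≤ 3 := by
    rw [← hα, Finset.card_eq_sum_ones]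
    refine (Finset.sum_le_sum fun l hl => ?_).trans
      (Finset.sum_le_sum_of_subset (Finset.subset_univ s))
    exact Nat.one_le_iff_ne_zero.2 (Finset.mem_filter.1 hl).2
  have hsub : (Finset.univ : Finset (Fin n × Fin n × Fin n)).filter (fun p =>
      Pi.single p.1 1 + Pi.single p.2.1 1 + Pi.single p.2.2 1 = α) ⊆ s ×ˢ s ×ˢ s := by
    rintro ⟨i, j, k⟩ hp
    obtain rfl := (Finset.mem_filter.1 hp).2
    simp [hs]
  refine (Finset.card_le_card hsub).trans ?_
  rw [Finset.card_product, Finset.card_product]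
  calc s.card * (s.card * s.card) ≤ 3 * (3 * 3) := by gcongr
    _ = 27 := by norm_num

set_option maxSynthPendingDepth 10 in
lemma norm_fderiv_fderiv_fderiv_le {n : ℕ} {U : EuclideanSpace ℝ (Fin n) → ℝ}
    (hU : ContDiff ℝ 3 U) (ξ : EuclideanSpace ℝ (Fin n)) :
    ‖fderiv ℝ (fderiv ℝ (fderiv ℝ U)) ξ‖ ≤ 162 * thirdOrderSum U ξ := by
  classical
  let A : Fin n × Fin n × Fin n → (Fin n → ℕ) := fun p =>
    Pi.single p.1 1 + Pi.single p.2.1 1 + Pi.single p.2.2 1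
  have hsum : ∀ p, ∑ i, A p i = 3 := fun p => by
    simp [A, Finset.sum_add_distrib]
  have hA : ∀ p ∈ (Finset.univ : Finset (Fin n × Fin n × Fin n)),
      A p ∈ (Finset.Iic (fun _ : Fin n => 3)).filter (fun α => ∑ i, α i = 3) := fun p _ => by
    refine Finset.mem_filter.2 ⟨Finset.mem_Iic.2 fun i => ?_, hsum p⟩
    rw [← hsum p]
    exact Finset.single_le_sum (fun _ _ => Nat.zero_le _) (Finset.mem_univ i)
  have hT : ∀ p : Fin n × Fin n × Fin n,
      ‖fderiv ℝ (fderiv ℝ (fderiv ℝ U)) ξ (EuclideanSpace.single p.1 1)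
        (EuclideanSpace.single p.2.1 1) (EuclideanSpace.single p.2.2 1)‖ =
        |epdMulti (A p) U ξ| := fun p => by
    have h : ∀ l, [p.1, p.2.1, p.2.2].count l = A p l := fun l => by
      simp only [A, List.count_cons, List.count_nil, Pi.add_apply, Pi.single_apply, beq_iff_eq,
        eq_comm (a := l)]
      ring
    rw [epdMulti_eq_foldr_of_count h hU, ← epd_epd_epd_apply hU, Real.norm_eq_abs]
    rfl
  calc ‖fderiv ℝ (fderiv ℝ (fderiv ℝ U)) ξ‖
      ≤ ∑ i, ∑ j, ∑ k, ‖fderiv ℝ (fderiv ℝ (fderiv ℝ U)) ξ (EuclideanSpace.single i 1)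
        (EuclideanSpace.single j 1) (EuclideanSpace.single k 1)‖ := by
        refine (EuclideanSpace.opNorm_le_sum_single _).trans (Finset.sum_le_sum fun i _ => ?_)
        refine (EuclideanSpace.opNorm_le_sum_single _).trans (Finset.sum_le_sum fun j _ => ?_)
        exact EuclideanSpace.opNorm_le_sum_single _
    _ = ∑ p : Fin n × Fin n × Fin n, |epdMulti (A p) U ξ| := by
        simp_rw [← hT, Fintype.sum_prod_type]
    _ = ∑ α ∈ (Finset.Iic (fun _ : Fin n => 3)).filter (fun α => ∑ i, α i = 3),
          ∑ p ∈ Finset.univ.filter (fun p => A p = α), |epdMulti (A p) U ξ| :=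
        (Finset.sum_fiberwise_of_maps_to hA _).symm
    _ ≤ ∑ α ∈ (Finset.Iic (fun _ : Fin n => 3)).filter (fun α => ∑ i, α i = 3),
          162 * (|epdMulti α U ξ| / ((emfact α : ℕ) : ℝ)) := by
        refine Finset.sum_le_sum fun α hα => ?_
        have hs : ∑ i, α i = 3 := (Finset.mem_filter.1 hα).2
        have h6 : ((emfact α : ℕ) : ℝ) ≤ 6 := by exact_mod_cast emfact_le_six hs
        have h0 : (0 : ℝ) < (emfact α : ℕ) := by
          exact_mod_cast Finset.prod_pos fun i _ => Nat.factorial_pos (α i)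
        have h27 : ((Finset.univ.filter (fun p => A p = α)).card : ℝ) ≤ 27 := by
          exact_mod_cast card_fiber_single_le α hs
        rw [Finset.sum_congr rfl (g := fun _ => |epdMulti α U ξ|)
          (fun p hp => by rw [(Finset.mem_filter.1 hp).2]), Finset.sum_const, nsmul_eq_mul]
        have ha := abs_nonneg (epdMulti α U ξ)
        have : |epdMulti α U ξ| / 6 ≤ |epdMulti α U ξ| / ((emfact α : ℕ) : ℝ) := by gcongr
        nlinarith
    _ = 162 * thirdOrderSum U ξ := by rw [thirdOrderSum, Finset.mul_sum]

lemma norm_fderiv_fderiv_sub_le {n : ℕ} {U : EuclideanSpace ℝ (Fin n) → ℝ}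
    (hU : ContDiff ℝ 3 U) {K : ℝ} (hK : ∀ ξ, ‖ξ‖ ≤ 1 → 162 * thirdOrderSum U ξ ≤ K)
    {x : EuclideanSpace ℝ (Fin n)} (hx : ‖x‖ ≤ 1) :
    ‖fderiv ℝ (fderiv ℝ U) x - fderiv ℝ (fderiv ℝ U) 0‖ ≤ K * ‖x‖ := by
  have h2 : ContDiff ℝ 1 (fderiv ℝ (fderiv ℝ U)) :=
    (hU.fderiv_right (m := 2) (by norm_num)).fderiv_right (by norm_num)
  have h := (convex_closedBall (0 : EuclideanSpace ℝ (Fin n)) 1).norm_image_sub_le_of_norm_fderiv_le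
    (𝕜 := ℝ) (f := fderiv ℝ (fderiv ℝ U)) (C := K) (x := 0) (y := x)
    (fun z _ => h2.differentiable (by norm_num) z)
    (fun z hz => (norm_fderiv_fderiv_fderiv_le hU z).trans (hK z (by simpa using hz)))
    (by simp) (by simpa using hx)
  simpa using h

section Taylor

variable {E : Type*} [NormedAddCommGroup E] [NormedSpace ℝ E] {U : E → ℝ}

lemma norm_fderiv_sub_le_of_norm_sub_le (hU : ContDiff ℝ 2 U) {B : E →L[ℝ] E →L[ℝ] ℝ} {r η : ℝ}
    (hB : ∀ x, ‖x‖ ≤ r → ‖fderiv ℝ (fderiv ℝ U) x - B‖ ≤ η) {w x : E} (hw : ‖w‖ ≤ r)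
    (hx : ‖x‖ ≤ r) : ‖fderiv ℝ U x - fderiv ℝ U w - B (x - w)‖ ≤ η * ‖x - w‖ :=
  (convex_closedBall (0 : E) r).norm_image_sub_le_of_norm_fderiv_le'
    (fun z _ => (hU.fderiv_right (m := 1) (by norm_num)).differentiable (by norm_num) z)
    (fun z hz => hB z (by simpa using hz)) (by simpa using hw) (by simpa using hx)

lemma abs_taylor_remainder_le (hU : ContDiff ℝ 2 U) {B : E →L[ℝ] E →L[ℝ] ℝ} {r η : ℝ}
    (hη : 0 ≤ η) (hB : ∀ x, ‖x‖ ≤ r → ‖fderiv ℝ (fderiv ℝ U) x - B‖ ≤ η) {w y : E}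
    (hw : ‖w‖ ≤ r) (hy : ‖w + y‖ ≤ r) :
    |U (w + y) - U w - fderiv ℝ U w y - B y y / 2| ≤ η * ‖y‖ ^ 2 := by
  let h : ℝ → ℝ := fun t => U (w + t • y) - t * fderiv ℝ U w y - t ^ 2 / 2 * B y y
  let h' : ℝ → ℝ := fun t => fderiv ℝ U (w + t • y) y - fderiv ℝ U w y - t * B y y
  have hd : ∀ t, HasDerivAt h (h' t) t := fun t => by
    have h1 : HasDerivAt (fun t : ℝ => w + t • y) y t := by
      simpa using ((hasDerivAt_id t).smul_const y).const_add w
    have h2 : HasDerivAt (fun t : ℝ => U (w + t • y)) (fderiv ℝ U (w + t • y) y) t :=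
      ((hU.differentiable (by norm_num)) (w + t • y)).hasFDerivAt.comp_hasDerivAt t h1
    have h3 : HasDerivAt (fun t : ℝ => t * fderiv ℝ U w y) (fderiv ℝ U w y) t := by
      simpa using (hasDerivAt_id t).mul_const (fderiv ℝ U w y)
    have h4 : HasDerivAt (fun t : ℝ => t ^ 2 / 2 * B y y) (t * B y y) t := by
      have := ((hasDerivAt_pow 2 t).div_const 2).mul_const (B y y)
      simpa using this
    exact (h2.sub h3).sub h4
  have hb : ∀ t ∈ Set.Ico (0 : ℝ) 1, ‖h' t‖ ≤ η * ‖y‖ ^ 2 := fun t ht => by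
    have hx : ‖w + t • y‖ ≤ r := by
      have hm := (convex_closedBall (0 : E) r).add_smul_mem (x := w) (y := y) (by simpa using hw)
        (by simpa using hy) ⟨ht.1, ht.2.le⟩
      simpa using hm
    have hg := norm_fderiv_sub_le_of_norm_sub_le hU hB hw hx
    rw [add_sub_cancel_left] at hg
    have he : h' t = (fderiv ℝ U (w + t • y) - fderiv ℝ U w - B (t • y)) y := by
      simp [h']
    rw [he]
    calc _ ≤ ‖fderiv ℝ U (w + t • y) - fderiv ℝ U w - B (t • y)‖ * ‖y‖ :=
          ContinuousLinearMap.le_opNorm _ _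
      _ ≤ η * ‖t • y‖ * ‖y‖ := by gcongr
      _ ≤ η * ‖y‖ * ‖y‖ := by
          gcongr
          rw [norm_smul, Real.norm_eq_abs, abs_of_nonneg ht.1]
          exact mul_le_of_le_one_left (norm_nonneg _) ht.2.le
      _ = _ := by ring
  have := norm_image_sub_le_of_norm_deriv_le_segment_01'
    (fun t _ => (hd t).hasDerivWithinAt) hb
  have he : h 1 - h 0 = U (w + y) - U w - fderiv ℝ U w y - B y y / 2 := by
    simp only [h, one_smul, zero_smul, add_zero]
    ring
  rwa [he] at this

lemma opNorm_le_of_symm_of_nonneg {B : E →L[ℝ] E →L[ℝ] ℝ} (hs : ∀ x y, B x y = B y x) {C : ℝ}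
    (hC : 0 ≤ C) (h0 : ∀ z, 0 ≤ B z z) (h1 : ∀ z, B z z ≤ C * ‖z‖ ^ 2) : ‖B‖ ≤ C := by
  refine B.opNorm_le_of_unit_norm hC fun x hx => ?_
  refine (B x).opNorm_le_of_unit_norm hC fun y hy => ?_
  have hp := h0 (x + y)
  have hm := h0 (x - y)
  have hxC := h1 x
  have hyC := h1 y
  simp only [map_add, map_sub, add_apply, sub_apply,
    hs y x, hx, hy] at hp hm hxC hyC
  rw [Real.norm_eq_abs, abs_le]
  constructor <;> linarith

/-- Uniform lower bound for the first order Taylor remainder around points close to the origin. -/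
lemma half_mul_sq_le_taylor_remainder (hU : ContDiff ℝ 2 U) {ω ω0 K : ℝ} (hω0 : 0 < ω0)
    (hω01 : ω0 < 1) (hQ : ∀ z, ω0 * ‖z‖ ^ 2 ≤ fderiv ℝ (fderiv ℝ U) 0 z z ∧
      fderiv ℝ (fderiv ℝ U) 0 z z ≤ ω0⁻¹ * ‖z‖ ^ 2)
    (hω : 0 < ω) (hωω0 : ω ≤ ω0 / 8)
    (hlow : ∀ z, ω * ‖z‖ ^ 2 ≤ U z - U 0 - fderiv ℝ U 0 z) (hK : 1 ≤ K)
    (hlip : ∀ x, ‖x‖ ≤ 1 → ‖fderiv ℝ (fderiv ℝ U) x - fderiv ℝ (fderiv ℝ U) 0‖ ≤ K * ‖x‖)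
    {w : E} (hw : ‖w‖ ≤ ω / (4 * (ω + (ω0⁻¹ + K))) * (ω0 / (8 * K))) (y : E) :
    ω / 2 * ‖y‖ ^ 2 ≤ U (w + y) - U w - fderiv ℝ U w y := by
  set B := fderiv ℝ (fderiv ℝ U) 0 with hBdef
  set C := ω0⁻¹ + K with hCdef
  set ε := ω / (4 * (ω + C)) with hεdef
  set r := ω0 / (4 * K) with hrdef
  have hinv : 0 < ω0⁻¹ := inv_pos.2 hω0
  have hC : 0 < C := by positivity
  have hε : 0 < ε := by positivity
  have hr : 0 < r := by positivity
  have hKr : K * r = ω0 / 4 := by rw [hrdef]; field_simp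
  have hεC : ε * (ω + C) = ω / 4 := by rw [hεdef]; field_simp
  have hr2 : ω0 / (8 * K) = r / 2 := by rw [hrdef]; field_simp; norm_num
  have hr1 : r ≤ 1 := by nlinarith
  have hε1 : ε ≤ 1 := by nlinarith
  rw [hr2] at hw
  have hwr : ‖w‖ ≤ r / 2 := hw.trans (mul_le_of_le_one_left (by positivity) hε1)
  rcases le_total ‖y‖ (r / 2) with hy | hy
  · have hwy : ‖w + y‖ ≤ r := (norm_add_le _ _).trans (by linarith)
    have hη : ∀ x, ‖x‖ ≤ r → ‖fderiv ℝ (fderiv ℝ U) x - B‖ ≤ ω0 / 4 := fun x hx =>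
      (hlip x (hx.trans hr1)).trans (by rw [← hKr]; gcongr)
    have h := (abs_le.1 (abs_taylor_remainder_le hU (by positivity) hη (by linarith) hwy)).1
    have hq := (hQ y).1
    nlinarith [sq_nonneg ‖y‖]
  · have hwε : ‖w‖ ≤ ε * ‖y‖ := hw.trans (by gcongr)
    have hs : ∀ x y, B x y = B y x := hU.contDiffAt.isSymmSndFDerivAt (by simp)
    have hBn : ‖B‖ ≤ ω0⁻¹ := opNorm_le_of_symm_of_nonneg hs hinv.le
      (fun z => le_trans (by positivity) (hQ z).1) (fun z => (hQ z).2)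
    have hw1 : ‖w‖ ≤ 1 := by linarith
    have hCb : ∀ x, ‖x‖ ≤ ‖w‖ → ‖fderiv ℝ (fderiv ℝ U) x - 0‖ ≤ C := fun x hx => by
      have h1 := hlip x (hx.trans hw1)
      have h2 : K * ‖x‖ ≤ K := mul_le_of_le_one_right (by positivity) (hx.trans hw1)
      have h3 := norm_add_le (fderiv ℝ (fderiv ℝ U) x - B) B
      rw [sub_add_cancel] at h3
      rw [sub_zero]
      linarith
    have hD : ‖fderiv ℝ U w - fderiv ℝ U 0‖ ≤ C * ‖w‖ := by
      simpa using norm_fderiv_sub_le_of_norm_sub_le hU hCb (w := 0) (x := w) (by simp) le_rfl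
    have hT : U w - U 0 - fderiv ℝ U 0 w ≤ C * ‖w‖ ^ 2 := by
      simpa using (abs_le.1 (abs_taylor_remainder_le hU hC.le hCb (w := 0) (y := w)
        (by simp) (by simp))).2
    have hDy : fderiv ℝ U w y - fderiv ℝ U 0 y ≤ C * ‖w‖ * ‖y‖ := by
      have h := (fderiv ℝ U w - fderiv ℝ U 0).le_of_opNorm_le hD y
      exact (le_abs_self _).trans (by simpa using h)
    have hl := hlow (w + y)
    rw [map_add] at hl
    have hn : ‖y‖ - ‖w‖ ≤ ‖w + y‖ := by
      have := norm_sub_le (w + y) w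
      rw [add_sub_cancel_left] at this
      linarith
    have hwn := norm_nonneg w
    have hyn := norm_nonneg y
    have hwy : ‖w‖ ≤ ‖y‖ := hwε.trans (mul_le_of_le_one_left hyn hε1)
    have hsq : (‖y‖ - ‖w‖) ^ 2 ≤ ‖w + y‖ ^ 2 := by
      have : 0 ≤ ‖y‖ - ‖w‖ := by linarith
      gcongr
    have hωsq := mul_le_mul_of_nonneg_left hsq hω.le
    have hww : C * ‖w‖ ^ 2 ≤ C * (‖w‖ * ‖y‖) := by
      rw [sq]; gcongr
    have hkey : (ω + C) * (‖w‖ * ‖y‖) ≤ ω / 4 * ‖y‖ ^ 2 := by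
      calc (ω + C) * (‖w‖ * ‖y‖) ≤ (ω + C) * (ε * ‖y‖ * ‖y‖) := by gcongr
        _ = ε * (ω + C) * ‖y‖ ^ 2 := by ring
        _ = _ := by rw [hεC]
    nlinarith [mul_nonneg hω.le (sq_nonneg ‖w‖)]

end Taylor

/-- Lower bound for the rescaled Taylor remainder of `U`, with `δ0` depending only on `ω`, `ω0`
and `M = sup_{|ξ|≤1} ∑_{|α|=3} |∂^α U(ξ)|/α!`: for all `β ≥ 1`, `|w| ≤ δ0` and all `z`,
`β (U(w + β^{-1/2} z) − U(w) − DU(w)(β^{-1/2} z)) ≥ (ω/2)|z|²`. -/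
theorem stmt3 :
    ∃ δ0 : ℝ → ℝ → ℝ → ℝ,
      ∀ (n : ℕ) (U : EuclideanSpace ℝ (Fin n) → ℝ) (ω ω0 : ℝ),
        ContDiff ℝ 3 U →
        0 < ω0 → ω0 < 1 →
        (∀ z : EuclideanSpace ℝ (Fin n),
          ω0 * ‖z‖ ^ 2 ≤ equad0 U z ∧ equad0 U z ≤ ω0⁻¹ * ‖z‖ ^ 2) →
        0 < ω → ω ≤ ω0 / 8 →
        (∀ z : EuclideanSpace ℝ (Fin n), ω * ‖z‖ ^ 2 ≤ U z - U 0 - fderiv ℝ U 0 z) →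
        ∀ M : ℝ,
          M = sSup {y : ℝ | ∃ ξ : EuclideanSpace ℝ (Fin n), ‖ξ‖ ≤ 1 ∧
              y = ∑ α ∈ (Finset.Iic (fun _ : Fin n => 3)).filter (fun α => ∑ i, α i = 3),
                |epdMulti α U ξ| / ((emfact α : ℕ) : ℝ)} →
          (0 < δ0 ω ω0 M ∧
            ∀ β : ℝ, 1 ≤ β → ∀ w : EuclideanSpace ℝ (Fin n), ‖w‖ ≤ δ0 ω ω0 M →
              ∀ z : EuclideanSpace ℝ (Fin n),
                ω / 2 * ‖z‖ ^ 2 ≤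
                  β * (U (w + (Real.sqrt β)⁻¹ • z) - U w -
                    fderiv ℝ U w ((Real.sqrt β)⁻¹ • z))) := by
  refine ⟨fun ω ω0 M => ω / (4 * (ω + (ω0⁻¹ + (162 * M + 1)))) * (ω0 / (8 * (162 * M + 1))), ?_⟩
  intro n U ω ω0 hU hω0 hω01 hQ hω hωω0 hlow M hM
  have hbound : ∀ ξ : EuclideanSpace ℝ (Fin n), ‖ξ‖ ≤ 1 → thirdOrderSum U ξ ≤ M := fun ξ hξ =>
    hM ▸ thirdOrderSum_le_sSup hU hξ
  have hM0 : 0 ≤ M := (thirdOrderSum_nonneg U 0).trans (hbound 0 (by simp))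
  have hlip : ∀ x : EuclideanSpace ℝ (Fin n), ‖x‖ ≤ 1 →
      ‖fderiv ℝ (fderiv ℝ U) x - fderiv ℝ (fderiv ℝ U) 0‖ ≤ (162 * M + 1) * ‖x‖ :=
    fun x hx => norm_fderiv_fderiv_sub_le hU (fun ξ hξ => by linarith [hbound ξ hξ]) hx
  refine ⟨by positivity, fun β hβ w hw z => ?_⟩
  have hβ0 : 0 < β := by linarith
  have key := half_mul_sq_le_taylor_remainder (hU.of_le (by norm_num)) hω0 hω01 hQ hω hωω0 hlow
    (by linarith) hlip hw ((Real.sqrt β)⁻¹ • z)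
  have hn : β * ‖(Real.sqrt β)⁻¹ • z‖ ^ 2 = ‖z‖ ^ 2 := by
    rw [norm_smul, mul_pow, Real.norm_eq_abs, sq_abs, inv_pow, Real.sq_sqrt hβ0.le,
      mul_inv_cancel_left₀ hβ0.ne']
  calc ω / 2 * ‖z‖ ^ 2 = β * (ω / 2 * ‖(Real.sqrt β)⁻¹ • z‖ ^ 2) := by rw [← hn]; ring
    _ ≤ _ := mul_le_mul_of_nonneg_left key hβ0.le
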